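/- Let μ be a nonzero finite positive Borel measure on the unit circle ∂𝔻 and let dν(z) = P_μ(z) dA(z) on 𝔻. For α sufficiently large, the integral operator S f(z) = ∫_𝔻 L(z,w) f(w) dν(w) with kernel L(z,w) = (1−|w|²)^α / (|1−zw̄|^{2+α} P_μ(w)) is bounded on L²(𝔻, dν); more precisely, this holds whenever there exists ε with 0 < ε < 1 and α > 1 − ε. -/

import Mathlib

open MeasureTheory

noncomputable section

/-- The Poisson integral `P_μ(z) = (1/2π) ∫_{∂𝔻} (1-|z|²)/|ζ-z|² dμ(ζ)` of a measure `μ`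
on the unit circle. -/
def poissonInt (μ : Measure ℂ) (z : ℂ) : ℝ :=
  (2 * Real.pi)⁻¹ * ∫ ζ, (1 - ‖z‖ ^ 2) / ‖ζ - z‖ ^ 2 ∂μ

/-- The measure `dν(z) = P_μ(z) dA(z)` on the unit disc. -/
def nuMeas (μ : Measure ℂ) : Measure ℂ :=
  (volume.restrict (Metric.ball (0:ℂ) 1)).withDensity
    fun z => ENNReal.ofReal (poissonInt μ z)

/-- The kernel `L(z,w) = (1-|w|²)^α / (|1-zw̄|^{2+α} P_μ(w))`. -/
def kernL (μ : Measure ℂ) (α : ℝ) (z w : ℂ) : ℝ :=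
  (1 - ‖w‖ ^ 2) ^ α / (‖1 - z * (starRingEnd ℂ) w‖ ^ (2 + α) * poissonInt μ w)

/-- **Schur test** on `L²` for a nonnegative kernel, with the same weight `h` on both sides. -/
lemma lintegral_sq_le_of_schur {X : Type*} [MeasurableSpace X] {ν : Measure X} [SFinite ν]
    {K : X → X → ENNReal} (hK : Measurable (Function.uncurry K)) {h : X → ENNReal}
    (hh : Measurable h) (h0 : ∀ᵐ x ∂ν, h x ≠ 0) (htop : ∀ᵐ x ∂ν, h x ≠ ⊤) {A B : ENNReal}
    (hA : ∀ᵐ z ∂ν, ∫⁻ w, K z w * h w ∂ν ≤ A * h z)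
    (hB : ∀ᵐ w ∂ν, ∫⁻ z, K z w * h z ∂ν ≤ B * h w) {g : X → ENNReal} (hg : Measurable g) :
    ∫⁻ z, (∫⁻ w, K z w * g w ∂ν) ^ 2 ∂ν ≤ A * B * ∫⁻ w, g w ^ 2 ∂ν := by
  have hKz : ∀ z, Measurable (K z) := fun z => hK.comp measurable_prodMk_left
  have hF : Measurable (Function.uncurry fun z w => h z * (K z w * (g w ^ 2 * (h w)⁻¹))) := by
    have : Measurable fun p : X × X => K p.1 p.2 := hK
    simp only [Function.uncurry_def]
    fun_prop
  have cauchy : ∀ z, (∫⁻ w, K z w * g w ∂ν) ^ 2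
      ≤ (∫⁻ w, K z w * h w ∂ν) * ∫⁻ w, K z w * (g w ^ 2 * (h w)⁻¹) ∂ν := by
    intro z
    have holder := ENNReal.lintegral_mul_norm_pow_le (μ := ν) (f := fun w => K z w * h w)
      (g := fun w => K z w * (g w ^ 2 * (h w)⁻¹)) (p := 1 / 2) (q := 1 / 2)
      (by have := hKz z; fun_prop) (by have := hKz z; fun_prop) (by norm_num) (by norm_num)
      (by norm_num)
    have hpt : ∫⁻ w, K z w * g w ∂ν = ∫⁻ w, (K z w * h w) ^ (1 / 2 : ℝ)
        * (K z w * (g w ^ 2 * (h w)⁻¹)) ^ (1 / 2 : ℝ) ∂ν := by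
      refine lintegral_congr_ae ?_
      filter_upwards [h0, htop] with w hw0 hwt
      rw [← ENNReal.mul_rpow_of_nonneg _ _ (by norm_num)]
      have : K z w * h w * (K z w * (g w ^ 2 * (h w)⁻¹)) = (K z w * g w) ^ 2 := by
        calc _ = (K z w * g w) ^ 2 * (h w * (h w)⁻¹) := by ring
          _ = _ := by rw [ENNReal.mul_inv_cancel hw0 hwt, mul_one]
      rw [this, ← ENNReal.rpow_natCast, ← ENNReal.rpow_mul]
      norm_num
    rw [← hpt] at holder
    calc _ ≤ _ := pow_le_pow_left' holder 2
      _ = _ := by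
        rw [mul_pow, ← ENNReal.rpow_natCast, ← ENNReal.rpow_mul, ← ENNReal.rpow_natCast,
          ← ENNReal.rpow_mul]
        norm_num
  calc ∫⁻ z, (∫⁻ w, K z w * g w ∂ν) ^ 2 ∂ν
      ≤ ∫⁻ z, A * ∫⁻ w, h z * (K z w * (g w ^ 2 * (h w)⁻¹)) ∂ν ∂ν := by
        refine lintegral_mono_ae ?_
        filter_upwards [hA] with z hz
        rw [lintegral_const_mul _ (by have := hKz z; fun_prop), ← mul_assoc]
        exact (cauchy z).trans (mul_le_mul_left hz _)
    _ = A * ∫⁻ w, ∫⁻ z, h z * (K z w * (g w ^ 2 * (h w)⁻¹)) ∂ν ∂ν := by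
        rw [lintegral_const_mul _ hF.lintegral_prod_right, lintegral_lintegral_swap hF.aemeasurable]
    _ ≤ A * ∫⁻ w, B * g w ^ 2 ∂ν := by
        refine mul_le_mul_right (lintegral_mono_ae ?_) _
        filter_upwards [hB, h0, htop] with w hw hw0 hwt
        have hKw : Measurable fun z => K z w := hK.comp measurable_prodMk_right
        calc ∫⁻ z, h z * (K z w * (g w ^ 2 * (h w)⁻¹)) ∂ν
            = ∫⁻ z, K z w * h z * (g w ^ 2 * (h w)⁻¹) ∂ν := by
              refine lintegral_congr fun z => ?_
              ring
          _ = (∫⁻ z, K z w * h z ∂ν) * (g w ^ 2 * (h w)⁻¹) :=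
              lintegral_mul_const _ (by fun_prop)
          _ ≤ B * h w * (g w ^ 2 * (h w)⁻¹) := mul_le_mul_left hw _
          _ = B * g w ^ 2 * (h w * (h w)⁻¹) := by ring
          _ = B * g w ^ 2 := by rw [ENNReal.mul_inv_cancel hw0 hwt, mul_one]
    _ = A * B * ∫⁻ w, g w ^ 2 ∂ν := by
        rw [lintegral_const_mul _ (by fun_prop), mul_assoc]

lemma exists_lintegral_rpow_mul_add_rpow_le {b q : ℝ} (hb : -1 < b) (hq : b + 1 < q) :
    ∃ C : ℝ, 0 ≤ C ∧ ∀ d : ℝ, 0 < d →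
      ∫⁻ t in Set.Ioi 0, ENNReal.ofReal (t ^ b * (t + d) ^ (-q))
        ≤ ENNReal.ofReal (C * d ^ (b + 1 - q)) := by
  refine ⟨1 / (b + 1) + 1 / (q - b - 1), ?_, fun d hd => ?_⟩
  · have h1 : 0 < b + 1 := by linarith
    have h2 : 0 < q - b - 1 := by linarith
    positivity
  have near : ∫⁻ t in Set.Ioc 0 d, ENNReal.ofReal (t ^ b * (t + d) ^ (-q))
      ≤ ENNReal.ofReal (1 / (b + 1) * d ^ (b + 1 - q)) := by
    have hintegrable : IntegrableOn (fun t : ℝ => t ^ b * d ^ (-q)) (Set.Ioc 0 d) :=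
      ((intervalIntegrable_iff_integrableOn_Ioc_of_le hd.le).1
        (intervalIntegral.intervalIntegrable_rpow' hb)).mul_const _
    calc _ ≤ ∫⁻ t in Set.Ioc 0 d, ENNReal.ofReal (t ^ b * d ^ (-q)) := by
          refine setLIntegral_mono' measurableSet_Ioc fun t ht => ENNReal.ofReal_le_ofReal ?_
          refine mul_le_mul_of_nonneg_left ?_ (Real.rpow_nonneg ht.1.le _)
          exact Real.rpow_le_rpow_of_nonpos hd (by linarith [ht.1]) (by linarith)
      _ = ENNReal.ofReal (∫ t in Set.Ioc 0 d, t ^ b * d ^ (-q)) := by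
          rw [ofReal_integral_eq_lintegral_ofReal hintegrable]
          filter_upwards [ae_restrict_mem measurableSet_Ioc] with t ht
          exact mul_nonneg (Real.rpow_nonneg ht.1.le _) (Real.rpow_nonneg hd.le _)
      _ = _ := by
          rw [integral_mul_const, ← intervalIntegral.integral_of_le hd.le,
            integral_rpow (Or.inl hb), Real.zero_rpow (by linarith), sub_eq_add_neg (b + 1),
            Real.rpow_add hd (b + 1)]
          congr 1
          ring
  have far : ∫⁻ t in Set.Ioi d, ENNReal.ofReal (t ^ b * (t + d) ^ (-q))
      ≤ ENNReal.ofReal (1 / (q - b - 1) * d ^ (b + 1 - q)) := by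
    have hlt : b - q < -1 := by linarith
    calc _ ≤ ∫⁻ t in Set.Ioi d, ENNReal.ofReal (t ^ (b - q)) := by
          refine setLIntegral_mono' measurableSet_Ioi fun t ht => ENNReal.ofReal_le_ofReal ?_
          have ht0 : 0 < t := hd.trans ht
          rw [sub_eq_add_neg, Real.rpow_add ht0]
          refine mul_le_mul_of_nonneg_left ?_ (Real.rpow_nonneg ht0.le _)
          exact Real.rpow_le_rpow_of_nonpos ht0 (by linarith) (by linarith)
      _ = ENNReal.ofReal (∫ t in Set.Ioi d, t ^ (b - q)) := by
          rw [ofReal_integral_eq_lintegral_ofReal (integrableOn_Ioi_rpow_of_lt hlt hd)]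
          filter_upwards [ae_restrict_mem measurableSet_Ioi] with t ht
          exact Real.rpow_nonneg (hd.trans ht).le _
      _ = _ := by
          rw [integral_Ioi_rpow_of_lt hlt hd, show b - q + 1 = -(q - b - 1) by ring,
            show b + 1 - q = -(q - b - 1) by ring, neg_div_neg_eq]
          congr 1
          ring
  rw [← Set.Ioc_union_Ioi_eq_Ioi hd.le,
    lintegral_union measurableSet_Ioi (Set.Ioc_disjoint_Ioi le_rfl), add_mul, ENNReal.ofReal_add]
  · exact add_le_add near far
  · have h1 : 0 < b + 1 := by linarith
    positivity
  · have h2 : 0 < q - b - 1 := by linarith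
    positivity

lemma exists_lintegral_add_abs_rpow_le {p : ℝ} (hp : 1 < p) :
    ∃ C : ℝ, 0 ≤ C ∧ ∀ t : ℝ, 0 < t →
      ∫⁻ θ : ℝ, ENNReal.ofReal ((t + |θ|) ^ (-p)) ≤ ENNReal.ofReal (C * t ^ (1 - p)) := by
  obtain ⟨C, hC, hbound⟩ := exists_lintegral_rpow_mul_add_rpow_le (b := 0) (q := p)
    (by norm_num) (by linarith)
  refine ⟨C + C, by positivity, fun t ht => ?_⟩
  have pos : ∫⁻ θ in Set.Ioi (0 : ℝ), ENNReal.ofReal ((t + |θ|) ^ (-p))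
      ≤ ENNReal.ofReal (C * t ^ (1 - p)) := by
    refine le_trans (le_of_eq ?_) ((hbound t ht).trans_eq (by rw [zero_add]))
    refine setLIntegral_congr_fun measurableSet_Ioi fun θ hθ => ?_
    simp only [Real.rpow_zero, one_mul, abs_of_pos (Set.mem_Ioi.1 hθ), add_comm]
  have neg : ∫⁻ θ in Set.Iio (0 : ℝ), ENNReal.ofReal ((t + |θ|) ^ (-p))
      = ∫⁻ θ in Set.Ioi (0 : ℝ), ENNReal.ofReal ((t + |θ|) ^ (-p)) := by
    have := (Measure.measurePreserving_neg (volume : Measure ℝ)).setLIntegral_comp_preimage_emb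
      (MeasurableEquiv.neg ℝ).measurableEmbedding
      (fun θ => ENNReal.ofReal ((t + |θ|) ^ (-p))) (Set.Ioi 0)
    simpa using this
  rw [← lintegral_add_compl _ (measurableSet_Ioi (a := (0 : ℝ))), Set.compl_Ioi,
    ← setLIntegral_congr Iio_ae_eq_Iic, neg, add_mul, ENNReal.ofReal_add (by positivity)
    (by positivity)]
  exact add_le_add pos pos

lemma add_abs_le_norm_one_sub_mul_exp {x r θ : ℝ} (hx : 0 ≤ x) (hxr : x ≤ r)
    (hθ : |θ| ≤ Real.pi) :
    1 - r + |θ| ≤ 9 * ‖(1 : ℂ) - x * (Real.cos θ + Real.sin θ * Complex.I)‖ := by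
  have hsq : ‖(1 : ℂ) - x * (Real.cos θ + Real.sin θ * Complex.I)‖ ^ 2
      = (1 - x) ^ 2 + 2 * x * (1 - Real.cos θ) := by
    rw [← Complex.normSq_eq_norm_sq, Complex.normSq_apply]
    simp only [Complex.sub_re, Complex.one_re, Complex.mul_re, Complex.add_re, Complex.ofReal_re,
      Complex.ofReal_im, Complex.I_re, Complex.I_im, Complex.sub_im, Complex.one_im,
      Complex.mul_im, Complex.add_im]
    linear_combination x ^ 2 * Real.sin_sq_add_cos_sq θ
  set N := ‖(1 : ℂ) - x * (Real.cos θ + Real.sin θ * Complex.I)‖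
  have hN : 0 ≤ N := norm_nonneg _
  have hpi := Real.pi_lt_four
  rcases le_total x (1 / 2) with h | h
  · have : 1 - x ≤ N := by
      refine abs_le_of_sq_le_sq' ?_ hN |>.2
      nlinarith [Real.cos_le_one θ]
    linarith
  · have hcos := Real.cos_le_one_sub_mul_cos_sq hθ
    have hpi2 : (1 : ℝ) / 8 ≤ 2 / Real.pi ^ 2 := by
      rw [div_le_div_iff₀ (by norm_num) (by positivity)]
      nlinarith [Real.pi_pos]
    have : 1 - x + |θ| ≤ 9 * N := by
      refine abs_le_of_sq_le_sq' ?_ (by positivity) |>.2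
      have h1 : θ ^ 2 / 8 ≤ 1 - Real.cos θ := by nlinarith [sq_nonneg θ]
      have h2 : (1 - x) ^ 2 + θ ^ 2 / 8 ≤ N ^ 2 := by nlinarith [sq_nonneg θ]
      nlinarith [sq_abs θ, sq_nonneg (1 - x - |θ|), sq_nonneg (1 - x), sq_nonneg θ]
    linarith

/-- Integrating a radial function against a power of `|1 - z ā|` over the disc reduces to a
one-dimensional integral, uniformly in `a` in the closed disc. -/
lemma exists_lintegral_ball_radial_mul_rpow_le {p : ℝ} (hp : 1 < p) :
    ∃ C : ℝ, 0 ≤ C ∧ ∀ φ : ℝ → ENNReal, Measurable φ → ∀ a : ℂ, ‖a‖ ≤ 1 →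
      ∫⁻ z in Metric.ball (0 : ℂ) 1,
          φ (1 - ‖z‖) * ENNReal.ofReal (‖1 - z * (starRingEnd ℂ) a‖ ^ (-p))
        ≤ ENNReal.ofReal C * ∫⁻ t in Set.Ioi 0, φ t * ENNReal.ofReal (t ^ (1 - p)) := by
  obtain ⟨C, hC, hbound⟩ := exists_lintegral_add_abs_rpow_le hp
  refine ⟨9 ^ p * C, by positivity, fun φ hφ a ha => ?_⟩
  set F : ℂ → ENNReal := (Metric.ball (0 : ℂ) 1).indicator fun z =>
    φ (1 - ‖z‖) * ENNReal.ofReal (‖1 - z * (starRingEnd ℂ) a‖ ^ (-p)) with hF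
  set H : ℝ → ENNReal := (Set.Ioi 0).indicator φ with hH
  have hHm : Measurable H := hφ.indicator measurableSet_Ioi
  set u : Circle := Circle.exp a.arg with hu
  have hua : (u : ℂ) * (starRingEnd ℂ) a = ‖a‖ := by
    have h1 : a = ‖a‖ * u := by
      rw [hu, Circle.coe_exp, Complex.norm_mul_exp_arg_mul_I]
    calc (u : ℂ) * (starRingEnd ℂ) a = u * (starRingEnd ℂ) (‖a‖ * u) := by rw [← h1]
      _ = ‖a‖ * (u * (starRingEnd ℂ) u) := by
        rw [map_mul, Complex.conj_ofReal]
        ring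
      _ = ‖a‖ := by rw [Complex.mul_conj, Circle.normSq_coe]; simp
  have polar : ∀ x ∈ polarCoord.target, ENNReal.ofReal x.1 • F (u * Complex.polarCoord.symm x)
      ≤ H (1 - x.1) * (ENNReal.ofReal (9 ^ p) * ENNReal.ofReal ((1 - x.1 + |x.2|) ^ (-p))) := by
    rintro ⟨r, θ⟩ ⟨hr, hθ⟩
    simp only [Set.mem_Ioi, Set.mem_Ioo] at hr hθ
    have hnorm : ‖(u : ℂ) * Complex.polarCoord.symm (r, θ)‖ = r := by
      rw [norm_mul, Circle.norm_coe, one_mul, Complex.norm_polarCoord_symm, abs_of_pos hr]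
    by_cases hr1 : r < 1
    · have hmem : (u : ℂ) * Complex.polarCoord.symm (r, θ) ∈ Metric.ball (0 : ℂ) 1 := by
        rwa [mem_ball_zero_iff, hnorm]
      have hmem' : 1 - r ∈ Set.Ioi (0 : ℝ) := sub_pos.2 hr1
      rw [hF, hH, Set.indicator_of_mem hmem, Set.indicator_of_mem hmem', hnorm, smul_eq_mul,
        ← ENNReal.ofReal_mul (by positivity)]
      have hlow := add_abs_le_norm_one_sub_mul_exp (x := ‖a‖ * r) (r := r) (θ := θ) (by positivity)
        (mul_le_of_le_one_left hr.le ha) (abs_le.2 ⟨hθ.1.le, hθ.2.le⟩)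
      have heq : (1 : ℂ) - u * Complex.polarCoord.symm (r, θ) * (starRingEnd ℂ) a
          = 1 - (‖a‖ * r : ℝ) * (Real.cos θ + Real.sin θ * Complex.I) := by
        rw [Complex.polarCoord_symm_apply]
        push_cast
        linear_combination (-(r : ℂ) * (Complex.cos θ + Complex.sin θ * Complex.I)) * hua
      rw [heq]
      set N := ‖(1 : ℂ) - (‖a‖ * r : ℝ) * (Real.cos θ + Real.sin θ * Complex.I)‖
      have hpos : 0 < 1 - r + |θ| := by have := abs_nonneg θ; linarith
      have hN : N ^ (-p) ≤ 9 ^ p * (1 - r + |θ|) ^ (-p) := by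
        calc N ^ (-p) ≤ ((1 - r + |θ|) / 9) ^ (-p) :=
              Real.rpow_le_rpow_of_nonpos (by positivity) (by linarith) (by linarith)
          _ = 9 ^ p * (1 - r + |θ|) ^ (-p) := by
              rw [Real.div_rpow hpos.le (by norm_num), Real.rpow_neg (by norm_num : (0 : ℝ) ≤ 9)]
              field_simp
      calc ENNReal.ofReal r * (φ (1 - r) * ENNReal.ofReal (N ^ (-p)))
          ≤ 1 * (φ (1 - r) * ENNReal.ofReal (9 ^ p * (1 - r + |θ|) ^ (-p))) := by
            gcongr
            exact ENNReal.ofReal_le_one.2 hr1.le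
        _ = _ := one_mul _
    · have hmem : (u : ℂ) * Complex.polarCoord.symm (r, θ) ∉ Metric.ball (0 : ℂ) 1 := by
        rwa [mem_ball_zero_iff, hnorm]
      rw [hF, Set.indicator_of_notMem hmem, smul_zero]
      exact zero_le
  have hGm : Measurable fun x : ℝ × ℝ =>
      H (1 - x.1) * (ENNReal.ofReal (9 ^ p) * ENNReal.ofReal ((1 - x.1 + |x.2|) ^ (-p))) := by
    fun_prop
  calc ∫⁻ z in Metric.ball (0 : ℂ) 1,
        φ (1 - ‖z‖) * ENNReal.ofReal (‖1 - z * (starRingEnd ℂ) a‖ ^ (-p))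
      = ∫⁻ z, F z := (lintegral_indicator Metric.isOpen_ball.measurableSet _).symm
    _ = ∫⁻ z, F (u * z) :=
        ((rotation u).measurePreserving.lintegral_comp_emb
          (rotation u).toHomeomorph.measurableEmbedding F).symm
    _ = ∫⁻ x in polarCoord.target, ENNReal.ofReal x.1 • F (u * Complex.polarCoord.symm x) :=
        (Complex.lintegral_comp_polarCoord_symm _).symm
    _ ≤ ∫⁻ x in polarCoord.target, H (1 - x.1) *
          (ENNReal.ofReal (9 ^ p) * ENNReal.ofReal ((1 - x.1 + |x.2|) ^ (-p))) :=
        setLIntegral_mono' polarCoord.open_target.measurableSet polar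
    _ ≤ ∫⁻ x : ℝ × ℝ, H (1 - x.1) *
          (ENNReal.ofReal (9 ^ p) * ENNReal.ofReal ((1 - x.1 + |x.2|) ^ (-p))) :=
        setLIntegral_le_lintegral _ _
    _ = ∫⁻ r, ∫⁻ θ, H (1 - r) *
          (ENNReal.ofReal (9 ^ p) * ENNReal.ofReal ((1 - r + |θ|) ^ (-p))) := by
        rw [Measure.volume_eq_prod, lintegral_prod _ hGm.aemeasurable]
    _ = ∫⁻ t, ∫⁻ θ, H t * (ENNReal.ofReal (9 ^ p) * ENNReal.ofReal ((t + |θ|) ^ (-p))) :=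
        lintegral_sub_left_eq_self (fun t => ∫⁻ θ, H t *
          (ENNReal.ofReal (9 ^ p) * ENNReal.ofReal ((t + |θ|) ^ (-p)))) 1
    _ ≤ ∫⁻ t, ENNReal.ofReal (9 ^ p * C) *
          (Set.Ioi 0).indicator (fun t => φ t * ENNReal.ofReal (t ^ (1 - p))) t := by
        refine lintegral_mono fun t => ?_
        dsimp only
        rw [lintegral_const_mul _ (by fun_prop), lintegral_const_mul _ (by fun_prop)]
        by_cases ht : t ∈ Set.Ioi (0 : ℝ)
        · rw [hH, Set.indicator_of_mem ht, Set.indicator_of_mem ht]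
          calc φ t * (ENNReal.ofReal (9 ^ p) * ∫⁻ θ : ℝ, ENNReal.ofReal ((t + |θ|) ^ (-p)))
              ≤ φ t * (ENNReal.ofReal (9 ^ p) * ENNReal.ofReal (C * t ^ (1 - p))) := by
                gcongr
                exact hbound t ht
            _ = _ := by
                rw [ENNReal.ofReal_mul hC, ENNReal.ofReal_mul (by positivity)]
                ring
        · rw [hH, Set.indicator_of_notMem ht, zero_mul]
          exact zero_le
    _ = _ := by
        rw [lintegral_const_mul _ ((by fun_prop : Measurable fun t : ℝ =>
          φ t * ENNReal.ofReal (t ^ (1 - p))).indicator measurableSet_Ioi),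
          lintegral_indicator measurableSet_Ioi]

lemma one_sub_sq_rpow_le {x : ℝ} (hx0 : 0 ≤ x) (hx1 : x < 1) (c : ℝ) :
    (1 - x ^ 2) ^ c ≤ 2 ^ |c| * (1 - x) ^ c := by
  have h1 : 0 < 1 - x := by linarith
  rw [show 1 - x ^ 2 = (1 + x) * (1 - x) by ring, Real.mul_rpow (by linarith) h1.le]
  refine mul_le_mul_of_nonneg_right ?_ (Real.rpow_nonneg h1.le _)
  calc (1 + x) ^ c ≤ (1 + x) ^ |c| := Real.rpow_le_rpow_of_exponent_le (by linarith) (le_abs_self c)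
    _ ≤ 2 ^ |c| := Real.rpow_le_rpow (by linarith) (by linarith) (abs_nonneg c)

lemma exists_lintegral_ball_rpow_le {c p q : ℝ} (hp : 1 < p) (hc : p < c + 2)
    (hq : c + 2 < p + q) :
    ∃ C : ℝ, 0 ≤ C ∧ ∀ a : ℂ, ‖a‖ ≤ 1 → ∀ d : ℝ, 0 < d →
      ∫⁻ z in Metric.ball (0 : ℂ) 1, ENNReal.ofReal ((1 - ‖z‖ ^ 2) ^ c *
          (‖1 - z * (starRingEnd ℂ) a‖ ^ (-p) * (1 - ‖z‖ + d) ^ (-q)))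
        ≤ ENNReal.ofReal (C * d ^ (c + 2 - p - q)) := by
  obtain ⟨A, hA, hradial⟩ := exists_lintegral_ball_radial_mul_rpow_le hp
  obtain ⟨B, hB, hline⟩ := exists_lintegral_rpow_mul_add_rpow_le (b := c + 1 - p) (q := q)
    (by linarith) (by linarith)
  refine ⟨2 ^ |c| * A * B, by positivity, fun a ha d hd => ?_⟩
  calc _ ≤ ∫⁻ z in Metric.ball (0 : ℂ) 1,
          ENNReal.ofReal (2 ^ |c| * ((1 - ‖z‖) ^ c * (1 - ‖z‖ + d) ^ (-q))) *
            ENNReal.ofReal (‖1 - z * (starRingEnd ℂ) a‖ ^ (-p)) := by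
        refine setLIntegral_mono' Metric.isOpen_ball.measurableSet fun z hz => ?_
        have hz1 : ‖z‖ < 1 := mem_ball_zero_iff.1 hz
        have hz2 : 0 < 1 - ‖z‖ := sub_pos.2 hz1
        rw [← ENNReal.ofReal_mul (by positivity)]
        refine ENNReal.ofReal_le_ofReal ?_
        calc _ ≤ 2 ^ |c| * (1 - ‖z‖) ^ c *
              (‖1 - z * (starRingEnd ℂ) a‖ ^ (-p) * (1 - ‖z‖ + d) ^ (-q)) :=
              mul_le_mul_of_nonneg_right (one_sub_sq_rpow_le (norm_nonneg z) hz1 c) (by positivity)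
          _ = _ := by ring
    _ ≤ ENNReal.ofReal A * ∫⁻ t in Set.Ioi 0,
          ENNReal.ofReal (2 ^ |c| * (t ^ c * (t + d) ^ (-q))) * ENNReal.ofReal (t ^ (1 - p)) :=
        hradial (fun t => ENNReal.ofReal (2 ^ |c| * (t ^ c * (t + d) ^ (-q)))) (by fun_prop) a ha
    _ = ENNReal.ofReal A * (ENNReal.ofReal (2 ^ |c|) *
          ∫⁻ t in Set.Ioi 0, ENNReal.ofReal (t ^ (c + 1 - p) * (t + d) ^ (-q))) := by
        rw [← lintegral_const_mul (ENNReal.ofReal (2 ^ |c|)) (by fun_prop)]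
        congr 1
        refine setLIntegral_congr_fun measurableSet_Ioi fun t ht => ?_
        have ht0 : 0 < t := ht
        rw [← ENNReal.ofReal_mul (by positivity), ← ENNReal.ofReal_mul (by positivity),
          show c + 1 - p = c + (1 - p) by ring, Real.rpow_add ht0]
        congr 1
        ring
    _ ≤ ENNReal.ofReal A * (ENNReal.ofReal (2 ^ |c|) *
          ENNReal.ofReal (B * d ^ (c + 1 - p + 1 - q))) := by
        gcongr
        exact hline d hd
    _ = _ := by
        rw [← ENNReal.ofReal_mul (by positivity), ← ENNReal.ofReal_mul (by positivity),
          show c + 1 - p + 1 - q = c + 2 - p - q by ring]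
        congr 1
        ring

lemma norm_one_sub_mul_conj_comm (z w : ℂ) :
    ‖1 - z * (starRingEnd ℂ) w‖ = ‖1 - w * (starRingEnd ℂ) z‖ := by
  rw [← Complex.norm_conj]
  simp [mul_comm]

lemma add_one_sub_sq_le_norm_one_sub_mul_conj {z w : ℂ} (hz : ‖z‖ < 1) (hw : ‖w‖ < 1) :
    1 - ‖z‖ + (1 - ‖w‖ ^ 2) ≤ 3 * ‖1 - z * (starRingEnd ℂ) w‖ := by
  have h : 1 - ‖z‖ * ‖w‖ ≤ ‖1 - z * (starRingEnd ℂ) w‖ := by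
    have := norm_sub_norm_le (1 : ℂ) (z * (starRingEnd ℂ) w)
    rwa [norm_one, norm_mul, Complex.norm_conj] at this
  nlinarith [norm_nonneg z, norm_nonneg w]

lemma norm_one_sub_mul_conj_rpow_le {z w : ℂ} (hz : ‖z‖ < 1) (hw : ‖w‖ < 1) {q : ℝ}
    (hq : 0 ≤ q) (p : ℝ) :
    ‖1 - z * (starRingEnd ℂ) w‖ ^ (-(p + q)) ≤ 3 ^ q *
      (‖1 - z * (starRingEnd ℂ) w‖ ^ (-p) * (1 - ‖z‖ + (1 - ‖w‖ ^ 2)) ^ (-q)) := by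
  have hlow := add_one_sub_sq_le_norm_one_sub_mul_conj hz hw
  set N := ‖1 - z * (starRingEnd ℂ) w‖
  have hs : 0 < 1 - ‖z‖ + (1 - ‖w‖ ^ 2) := by nlinarith [norm_nonneg w]
  set s := 1 - ‖z‖ + (1 - ‖w‖ ^ 2)
  have hN : 0 < N := by linarith
  have hle : N ^ (-q) ≤ 3 ^ q * s ^ (-q) := by
    calc N ^ (-q) ≤ (s / 3) ^ (-q) :=
          Real.rpow_le_rpow_of_nonpos (by positivity) (by linarith) (by linarith)
      _ = 3 ^ q * s ^ (-q) := by
          rw [Real.div_rpow hs.le (by norm_num), Real.rpow_neg (by norm_num : (0 : ℝ) ≤ 3)]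
          field_simp
  rw [neg_add, Real.rpow_add hN]
  calc N ^ (-p) * N ^ (-q) ≤ N ^ (-p) * (3 ^ q * s ^ (-q)) :=
        mul_le_mul_of_nonneg_left hle (by positivity)
    _ = _ := by ring

/-- The Forelli–Rudin estimate for the weight `(1 - |w|²)^(-ε)`. -/
lemma exists_lintegral_ball_kernel_le {α ε : ℝ} (hε0 : 0 < ε) (hε1 : ε < 1) (hα : 0 < α) :
    ∃ C : ℝ, 0 ≤ C ∧ ∀ z : ℂ, ‖z‖ < 1 →
      ∫⁻ w in Metric.ball (0 : ℂ) 1, ENNReal.ofReal ((1 - ‖w‖ ^ 2) ^ (α - ε) *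
          ‖1 - z * (starRingEnd ℂ) w‖ ^ (-(2 + α)))
        ≤ ENNReal.ofReal (C * (1 - ‖z‖ ^ 2) ^ (-ε)) := by
  set p := 1 + (1 - ε) / 2 with hp
  set q := 1 + α - (1 - ε) / 2 with hq
  obtain ⟨C, hC, hbound⟩ := exists_lintegral_ball_rpow_le (c := α - ε) (p := p) (q := q)
    (by linarith) (by linarith) (by linarith)
  refine ⟨3 ^ q * C, by positivity, fun z hz => ?_⟩
  have hd : 0 < 1 - ‖z‖ ^ 2 := by nlinarith [norm_nonneg z]
  calc _ ≤ ∫⁻ w in Metric.ball (0 : ℂ) 1, ENNReal.ofReal (3 ^ q) *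
          ENNReal.ofReal ((1 - ‖w‖ ^ 2) ^ (α - ε) *
          (‖1 - w * (starRingEnd ℂ) z‖ ^ (-p) * (1 - ‖w‖ + (1 - ‖z‖ ^ 2)) ^ (-q))) := by
        refine setLIntegral_mono' Metric.isOpen_ball.measurableSet fun w hw => ?_
        have hw1 : ‖w‖ < 1 := mem_ball_zero_iff.1 hw
        have hw2 : 0 < 1 - ‖w‖ ^ 2 := by nlinarith [norm_nonneg w]
        rw [← ENNReal.ofReal_mul (by positivity), norm_one_sub_mul_conj_comm z w,
          show 2 + α = p + q by rw [hp, hq]; ring]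
        refine ENNReal.ofReal_le_ofReal ?_
        calc _ ≤ (1 - ‖w‖ ^ 2) ^ (α - ε) * (3 ^ q * (‖1 - w * (starRingEnd ℂ) z‖ ^ (-p) *
              (1 - ‖w‖ + (1 - ‖z‖ ^ 2)) ^ (-q))) :=
              mul_le_mul_of_nonneg_left
                (norm_one_sub_mul_conj_rpow_le hw1 hz (by linarith) p) (by positivity)
          _ = _ := by ring
    _ ≤ ENNReal.ofReal (3 ^ q) *
          ENNReal.ofReal (C * (1 - ‖z‖ ^ 2) ^ (α - ε + 2 - p - q)) := by
        rw [lintegral_const_mul _ (by fun_prop)]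
        gcongr
        exact hbound z hz.le _ hd
    _ = _ := by
        rw [← ENNReal.ofReal_mul (by positivity), mul_assoc,
          show α - ε + 2 - p - q = -ε by rw [hp, hq]; ring]

lemma norm_sub_eq_norm_one_sub_mul_conj {ζ : ℂ} (hζ : ‖ζ‖ = 1) (z : ℂ) :
    ‖ζ - z‖ = ‖1 - z * (starRingEnd ℂ) ζ‖ := by
  have h1 : ζ * (starRingEnd ℂ) ζ = 1 := by
    rw [Complex.mul_conj, Complex.normSq_eq_norm_sq, hζ]
    simp
  rw [← h1, ← sub_mul, norm_mul, Complex.norm_conj, hζ, mul_one]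

lemma norm_sub_le_norm_one_sub_mul_conj {z w : ℂ} (hz : ‖z‖ ≤ 1) (hw : ‖w‖ ≤ 1) :
    ‖z - w‖ ≤ ‖1 - z * (starRingEnd ℂ) w‖ := by
  refine abs_le_of_sq_le_sq' ?_ (norm_nonneg _) |>.2
  have h : ‖1 - z * (starRingEnd ℂ) w‖ ^ 2 - ‖z - w‖ ^ 2 = (1 - ‖z‖ ^ 2) * (1 - ‖w‖ ^ 2) := by
    simp only [← Complex.normSq_eq_norm_sq, Complex.normSq_apply, Complex.sub_re, Complex.sub_im,
      Complex.mul_re, Complex.mul_im, Complex.one_re, Complex.one_im, Complex.conj_re,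
      Complex.conj_im]
    ring
  have h1 : 0 ≤ 1 - ‖z‖ ^ 2 := by nlinarith [norm_nonneg z]
  have h2 : 0 ≤ 1 - ‖w‖ ^ 2 := by nlinarith [norm_nonneg w]
  nlinarith [mul_nonneg h1 h2]

/-- The weighted integral of a Poisson kernel is controlled by the Poisson kernel itself. -/
lemma exists_lintegral_ball_poisson_le {α ε : ℝ} (hε1 : ε < 1) (hα0 : 0 < α) (hα : 1 - ε < α) :
    ∃ C : ℝ, 0 ≤ C ∧ ∀ ζ w : ℂ, ‖ζ‖ = 1 → ‖w‖ < 1 →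
      ∫⁻ z in Metric.ball (0 : ℂ) 1, ENNReal.ofReal (‖1 - z * (starRingEnd ℂ) w‖ ^ (-(2 + α)) *
          (1 - ‖z‖ ^ 2) ^ (-ε)) * ENNReal.ofReal ((1 - ‖z‖ ^ 2) / ‖ζ - z‖ ^ 2)
        ≤ ENNReal.ofReal (C * (1 - ‖w‖ ^ 2) ^ (-ε - α)) *
          ENNReal.ofReal ((1 - ‖w‖ ^ 2) / ‖ζ - w‖ ^ 2) := by
  obtain ⟨C, hC, hbound⟩ := exists_lintegral_ball_rpow_le (c := 1 - ε) (p := 2) (q := α)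
    (by norm_num) (by linarith) (by linarith)
  refine ⟨2 * 3 ^ α * (C + C), by positivity, fun ζ w hζ hw => ?_⟩
  have hd : 0 < 1 - ‖w‖ ^ 2 := by nlinarith [norm_nonneg w]
  have hE : 0 < ‖ζ - w‖ := by
    have := norm_sub_norm_le ζ w
    linarith
  set f : ℂ → ℂ → ℝ := fun a z => (1 - ‖z‖ ^ 2) ^ (1 - ε) *
    (‖1 - z * (starRingEnd ℂ) a‖ ^ (-2 : ℝ) * (1 - ‖z‖ + (1 - ‖w‖ ^ 2)) ^ (-α)) with hf
  have hfm : ∀ a, Measurable (f a) := fun a => by fun_prop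
  set κ : ℝ := 2 * 3 ^ α / ‖ζ - w‖ ^ 2 with hκ
  have hκ0 : 0 ≤ κ := by positivity
  calc _ ≤ ∫⁻ z in Metric.ball (0 : ℂ) 1, ENNReal.ofReal κ *
          (ENNReal.ofReal (f w z) + ENNReal.ofReal (f ζ z)) := by
        refine setLIntegral_mono' Metric.isOpen_ball.measurableSet fun z hz => ?_
        have hz1 : ‖z‖ < 1 := mem_ball_zero_iff.1 hz
        have hz2 : 0 < 1 - ‖z‖ ^ 2 := by nlinarith [norm_nonneg z]
        have hs : 0 < 1 - ‖z‖ + (1 - ‖w‖ ^ 2) := by linarith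
        have hM : 0 < ‖ζ - z‖ := by
          have := norm_sub_norm_le ζ z
          linarith
        have hN : 0 < ‖1 - z * (starRingEnd ℂ) w‖ := by
          linarith [add_one_sub_sq_le_norm_one_sub_mul_conj hz1 hw]
        have tri : ‖ζ - w‖ ≤ ‖ζ - z‖ + ‖1 - z * (starRingEnd ℂ) w‖ :=
          (norm_sub_le_norm_sub_add_norm_sub ζ z w).trans
            (add_le_add_right (norm_sub_le_norm_one_sub_mul_conj hz1.le hw.le) _)
        have split0 := norm_one_sub_mul_conj_rpow_le hz1 hw hα0.le 0
        rw [zero_add, neg_zero, Real.rpow_zero, one_mul] at split0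
        have hf0 : ∀ a, 0 ≤ f a z := fun a => by positivity
        rw [← ENNReal.ofReal_mul (by positivity), ← ENNReal.ofReal_add (hf0 _) (hf0 _),
          ← ENNReal.ofReal_mul hκ0]
        refine ENNReal.ofReal_le_ofReal ?_
        simp only [hf, ← norm_sub_eq_norm_one_sub_mul_conj hζ]
        set N := ‖1 - z * (starRingEnd ℂ) w‖
        set M := ‖ζ - z‖
        set E := ‖ζ - w‖
        set x := 1 - ‖z‖ ^ 2
        set s := 1 - ‖z‖ + (1 - ‖w‖ ^ 2)
        have hx : x ^ (1 - ε) = x ^ (-ε) * x := by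
          rw [show 1 - ε = -ε + 1 by ring, Real.rpow_add_one hz2.ne']
        have hN2 : N ^ (-(2 + α)) = N ^ (-α) * (N ^ 2)⁻¹ := by
          rw [neg_add, add_comm, Real.rpow_add hN, Real.rpow_neg hN.le, Real.rpow_neg hN.le,
            Real.rpow_two]
        have hpt : (N ^ 2)⁻¹ * (M ^ 2)⁻¹ ≤ 2 / E ^ 2 * ((N ^ 2)⁻¹ + (M ^ 2)⁻¹) := by
          have hE2 : E ^ 2 ≤ 2 * (N ^ 2 + M ^ 2) := by nlinarith [sq_nonneg (M - N)]
          have : 2 / E ^ 2 * ((N ^ 2)⁻¹ + (M ^ 2)⁻¹) - (N ^ 2)⁻¹ * (M ^ 2)⁻¹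
              = (2 * (N ^ 2 + M ^ 2) - E ^ 2) / (E ^ 2 * N ^ 2 * M ^ 2) := by
            field_simp
            ring
          have h0 : 0 ≤ (2 * (N ^ 2 + M ^ 2) - E ^ 2) / (E ^ 2 * N ^ 2 * M ^ 2) :=
            div_nonneg (by linarith) (by positivity)
          linarith
        rw [hN2, hx, Real.rpow_neg hN.le 2, Real.rpow_neg hM.le 2, Real.rpow_two, Real.rpow_two, hκ]
        calc N ^ (-α) * (N ^ 2)⁻¹ * x ^ (-ε) * (x / M ^ 2)
            = N ^ (-α) * ((N ^ 2)⁻¹ * (M ^ 2)⁻¹) * (x ^ (-ε) * x) := by ring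
          _ ≤ 3 ^ α * s ^ (-α) * (2 / E ^ 2 * ((N ^ 2)⁻¹ + (M ^ 2)⁻¹)) * (x ^ (-ε) * x) := by
              gcongr
          _ = _ := by ring
    _ = ENNReal.ofReal κ * (∫⁻ z in Metric.ball (0 : ℂ) 1, ENNReal.ofReal (f w z) +
          ENNReal.ofReal (f ζ z)) :=
        lintegral_const_mul _ (by have := hfm w; have := hfm ζ; fun_prop)
    _ ≤ ENNReal.ofReal κ * (ENNReal.ofReal (C * (1 - ‖w‖ ^ 2) ^ (1 - ε + 2 - 2 - α)) +
          ENNReal.ofReal (C * (1 - ‖w‖ ^ 2) ^ (1 - ε + 2 - 2 - α))) := by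
        rw [lintegral_add_left (hfm w).ennreal_ofReal]
        gcongr
        · exact hbound w hw.le _ hd
        · exact hbound ζ hζ.le _ hd
    _ = _ := by
        rw [← ENNReal.ofReal_add (by positivity) (by positivity), ← ENNReal.ofReal_mul hκ0,
          ← ENNReal.ofReal_mul (by positivity), hκ,
          show 1 - ε + 2 - 2 - α = (-ε - α) + 1 by ring, Real.rpow_add_one hd.ne']
        congr 1
        ring

lemma measurable_poissonInt (μ : Measure ℂ) [SFinite μ] : Measurable (poissonInt μ) := by
  have h : StronglyMeasurable (Function.uncurry fun z ζ : ℂ => (1 - ‖z‖ ^ 2) / ‖ζ - z‖ ^ 2) := by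
    refine Measurable.stronglyMeasurable ?_
    simp only [Function.uncurry_def]
    fun_prop
  exact h.integral_prod_right.measurable.const_mul _

lemma ae_norm_eq_one {μ : Measure ℂ} (hμ : μ ((Metric.sphere (0 : ℂ) 1)ᶜ) = 0) :
    ∀ᵐ ζ ∂μ, ‖ζ‖ = 1 := by
  refine measure_mono_null (fun ζ hζ => ?_) hμ
  simpa using hζ

lemma ofReal_poissonInt (μ : Measure ℂ) [IsFiniteMeasure μ]
    (hμ : μ ((Metric.sphere (0 : ℂ) 1)ᶜ) = 0) {z : ℂ} (hz : ‖z‖ < 1) :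
    ENNReal.ofReal (poissonInt μ z) = ENNReal.ofReal (2 * Real.pi)⁻¹ *
      ∫⁻ ζ, ENNReal.ofReal ((1 - ‖z‖ ^ 2) / ‖ζ - z‖ ^ 2) ∂μ := by
  have hd : 0 < 1 - ‖z‖ ^ 2 := by nlinarith [norm_nonneg z]
  have hintegrable : Integrable (fun ζ => (1 - ‖z‖ ^ 2) / ‖ζ - z‖ ^ 2) μ := by
    refine Integrable.of_bound (C := (1 - ‖z‖ ^ 2) / (1 - ‖z‖) ^ 2)
      (by fun_prop : Measurable _).aestronglyMeasurable ?_
    filter_upwards [ae_norm_eq_one hμ] with ζ hζ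
    have h1 : 1 - ‖z‖ ≤ ‖ζ - z‖ := hζ ▸ norm_sub_norm_le ζ z
    have h2 : 0 < 1 - ‖z‖ := sub_pos.2 hz
    rw [Real.norm_of_nonneg (by positivity)]
    gcongr
  rw [poissonInt, ENNReal.ofReal_mul (by positivity), ofReal_integral_eq_lintegral_ofReal hintegrable]
  exact Filter.Eventually.of_forall fun ζ => div_nonneg hd.le (by positivity)

lemma lintegral_nuMeas (μ : Measure ℂ) [SFinite μ] {f : ℂ → ENNReal} (hf : Measurable f) :
    ∫⁻ z, f z ∂(nuMeas μ)
      = ∫⁻ z in Metric.ball (0 : ℂ) 1, ENNReal.ofReal (poissonInt μ z) * f z :=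
  lintegral_withDensity_eq_lintegral_mul _ (measurable_poissonInt μ).ennreal_ofReal hf

lemma measurable_kernL (μ : Measure ℂ) [SFinite μ] (α : ℝ) :
    Measurable (Function.uncurry fun z w => ENNReal.ofReal (kernL μ α z w)) := by
  have := measurable_poissonInt μ
  simp only [Function.uncurry_def, kernL]
  fun_prop

lemma ae_nuMeas_norm_lt_one (μ : Measure ℂ) : ∀ᵐ z ∂(nuMeas μ), ‖z‖ < 1 := by
  refine (withDensity_absolutelyContinuous _ _).ae_le ?_
  filter_upwards [ae_restrict_mem Metric.isOpen_ball.measurableSet] with z hz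
  exact mem_ball_zero_iff.1 hz

lemma poissonInt_nonneg (μ : Measure ℂ) {z : ℂ} (hz : ‖z‖ < 1) : 0 ≤ poissonInt μ z := by
  have hd : 0 < 1 - ‖z‖ ^ 2 := by nlinarith [norm_nonneg z]
  exact mul_nonneg (by positivity) (integral_nonneg fun ζ => by positivity)

lemma exists_lintegral_kernL_mul_le (μ : Measure ℂ) [SFinite μ] {α ε : ℝ} (hε0 : 0 < ε)
    (hε1 : ε < 1) (hα : 0 < α) :
    ∃ C : ℝ, 0 ≤ C ∧ ∀ z : ℂ, ‖z‖ < 1 →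
      ∫⁻ w, ENNReal.ofReal (kernL μ α z w) * ENNReal.ofReal ((1 - ‖w‖ ^ 2) ^ (-ε)) ∂(nuMeas μ)
        ≤ ENNReal.ofReal C * ENNReal.ofReal ((1 - ‖z‖ ^ 2) ^ (-ε)) := by
  obtain ⟨A, hA, hrow⟩ := exists_lintegral_ball_kernel_le hε0 hε1 hα
  refine ⟨A, hA, fun z hz => ?_⟩
  have hKz : Measurable fun w => ENNReal.ofReal (kernL μ α z w) :=
    (measurable_kernL μ α).of_uncurry_left
  rw [lintegral_nuMeas μ (by fun_prop), ← ENNReal.ofReal_mul hA]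
  refine le_trans ?_ (hrow z hz)
  refine setLIntegral_mono' Metric.isOpen_ball.measurableSet fun w hw => ?_
  have hw1 : ‖w‖ < 1 := mem_ball_zero_iff.1 hw
  have hd : 0 < 1 - ‖w‖ ^ 2 := by nlinarith [norm_nonneg w]
  have hP := poissonInt_nonneg μ hw1
  have hk : 0 ≤ kernL μ α z w := by unfold kernL; positivity
  rw [← ENNReal.ofReal_mul hk, ← ENNReal.ofReal_mul hP]
  refine ENNReal.ofReal_le_ofReal ?_
  rcases hP.eq_or_lt with hP0 | hP0
  · rw [← hP0, zero_mul]
    positivity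
  · have hcancel : poissonInt μ w * (poissonInt μ w)⁻¹ = 1 := mul_inv_cancel₀ hP0.ne'
    rw [kernL, sub_eq_add_neg α, Real.rpow_add hd, Real.rpow_neg (norm_nonneg _), div_eq_mul_inv,
      mul_inv]
    refine le_of_eq ?_
    linear_combination (1 - ‖w‖ ^ 2) ^ α * (‖1 - z * (starRingEnd ℂ) w‖ ^ (2 + α))⁻¹ *
      (1 - ‖w‖ ^ 2) ^ (-ε) * hcancel

lemma exists_lintegral_mul_kernL_le (μ : Measure ℂ) [IsFiniteMeasure μ]
    (hμ : μ ((Metric.sphere (0 : ℂ) 1)ᶜ) = 0) {α ε : ℝ} (hε1 : ε < 1) (hα0 : 0 < α)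
    (hα : 1 - ε < α) :
    ∃ C : ℝ, 0 ≤ C ∧ ∀ w : ℂ, ‖w‖ < 1 →
      ∫⁻ z, ENNReal.ofReal (kernL μ α z w) * ENNReal.ofReal ((1 - ‖z‖ ^ 2) ^ (-ε)) ∂(nuMeas μ)
        ≤ ENNReal.ofReal C * ENNReal.ofReal ((1 - ‖w‖ ^ 2) ^ (-ε)) := by
  obtain ⟨B, hB, hcol⟩ := exists_lintegral_ball_poisson_le hε1 hα0 hα
  refine ⟨B, hB, fun w hw => ?_⟩
  have hd : 0 < 1 - ‖w‖ ^ 2 := by nlinarith [norm_nonneg w]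
  have hP := poissonInt_nonneg μ hw
  have hKw : Measurable fun z => ENNReal.ofReal (kernL μ α z w) :=
    (measurable_kernL μ α).of_uncurry_right
  rcases hP.eq_or_lt with hP0 | hP0
  · simp [kernL, ← hP0]
  set T : ℂ → ENNReal := fun z => ENNReal.ofReal (‖1 - z * (starRingEnd ℂ) w‖ ^ (-(2 + α)) *
    (1 - ‖z‖ ^ 2) ^ (-ε))
  have hTm : Measurable T := by fun_prop
  have hQm : Measurable fun x : ℂ × ℂ => ENNReal.ofReal ((1 - ‖x.1‖ ^ 2) / ‖x.2 - x.1‖ ^ 2) := by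
    fun_prop
  set κ := ENNReal.ofReal (2 * Real.pi)⁻¹
  have swap : ∫⁻ z in Metric.ball (0 : ℂ) 1,
      T z * ∫⁻ ζ, ENNReal.ofReal ((1 - ‖z‖ ^ 2) / ‖ζ - z‖ ^ 2) ∂μ
      ≤ ENNReal.ofReal (B * (1 - ‖w‖ ^ 2) ^ (-ε - α)) *
        ∫⁻ ζ, ENNReal.ofReal ((1 - ‖w‖ ^ 2) / ‖ζ - w‖ ^ 2) ∂μ := by
    calc _ = ∫⁻ z in Metric.ball (0 : ℂ) 1,
          ∫⁻ ζ, T z * ENNReal.ofReal ((1 - ‖z‖ ^ 2) / ‖ζ - z‖ ^ 2) ∂μ :=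
          lintegral_congr fun z => (lintegral_const_mul _ (by fun_prop)).symm
      _ = ∫⁻ ζ, (∫⁻ z in Metric.ball (0 : ℂ) 1,
          T z * ENNReal.ofReal ((1 - ‖z‖ ^ 2) / ‖ζ - z‖ ^ 2)) ∂μ :=
          lintegral_lintegral_swap ((hTm.comp measurable_fst).mul hQm).aemeasurable
      _ ≤ ∫⁻ ζ, ENNReal.ofReal (B * (1 - ‖w‖ ^ 2) ^ (-ε - α)) *
          ENNReal.ofReal ((1 - ‖w‖ ^ 2) / ‖ζ - w‖ ^ 2) ∂μ := by
          refine lintegral_mono_ae ?_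
          filter_upwards [ae_norm_eq_one hμ] with ζ hζ
          exact hcol ζ w hζ hw
      _ = _ := lintegral_const_mul _ (by fun_prop)
  calc ∫⁻ z, ENNReal.ofReal (kernL μ α z w) * ENNReal.ofReal ((1 - ‖z‖ ^ 2) ^ (-ε)) ∂(nuMeas μ)
      = ∫⁻ z in Metric.ball (0 : ℂ) 1,
          ENNReal.ofReal (poissonInt μ z) *
            (ENNReal.ofReal (kernL μ α z w) * ENNReal.ofReal ((1 - ‖z‖ ^ 2) ^ (-ε))) :=
        lintegral_nuMeas μ (by fun_prop)
    _ = ∫⁻ z in Metric.ball (0 : ℂ) 1,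
          ENNReal.ofReal ((1 - ‖w‖ ^ 2) ^ α / poissonInt μ w) * κ *
          (T z * ∫⁻ ζ, ENNReal.ofReal ((1 - ‖z‖ ^ 2) / ‖ζ - z‖ ^ 2) ∂μ) := by
        refine setLIntegral_congr_fun Metric.isOpen_ball.measurableSet fun z hz => ?_
        have hz1 : ‖z‖ < 1 := mem_ball_zero_iff.1 hz
        have hk : 0 ≤ kernL μ α z w := by unfold kernL; positivity
        have hkT : ENNReal.ofReal (kernL μ α z w) * ENNReal.ofReal ((1 - ‖z‖ ^ 2) ^ (-ε))
            = ENNReal.ofReal ((1 - ‖w‖ ^ 2) ^ α / poissonInt μ w) * T z := by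
          rw [← ENNReal.ofReal_mul hk, ← ENNReal.ofReal_mul (by positivity), kernL,
            Real.rpow_neg (norm_nonneg _)]
          congr 1
          field_simp
        rw [hkT, ofReal_poissonInt μ hμ hz1]
        ring
    _ ≤ ENNReal.ofReal ((1 - ‖w‖ ^ 2) ^ α / poissonInt μ w) * κ *
          (ENNReal.ofReal (B * (1 - ‖w‖ ^ 2) ^ (-ε - α)) *
          ∫⁻ ζ, ENNReal.ofReal ((1 - ‖w‖ ^ 2) / ‖ζ - w‖ ^ 2) ∂μ) := by
        have hm : Measurable fun z =>
            T z * ∫⁻ ζ, ENNReal.ofReal ((1 - ‖z‖ ^ 2) / ‖ζ - z‖ ^ 2) ∂μ :=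
          hTm.mul hQm.lintegral_prod_right'
        rw [lintegral_const_mul _ hm]
        gcongr
    _ = ENNReal.ofReal ((1 - ‖w‖ ^ 2) ^ α / poissonInt μ w) *
          (ENNReal.ofReal (B * (1 - ‖w‖ ^ 2) ^ (-ε - α)) * ENNReal.ofReal (poissonInt μ w)) := by
        rw [ofReal_poissonInt μ hμ hw]
        ring
    _ = ENNReal.ofReal B * ENNReal.ofReal ((1 - ‖w‖ ^ 2) ^ (-ε)) := by
        rw [← ENNReal.ofReal_mul (by positivity), ← ENNReal.ofReal_mul (by positivity),
          ← ENNReal.ofReal_mul hB, sub_eq_add_neg (-ε), Real.rpow_add hd, Real.rpow_neg hd.le α]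
        congr 1
        field_simp

/-- Boundedness on `L²(𝔻, dν)` of the positive integral operator
`Sf(z) = ∫_𝔻 L(z,w) f(w) dν(w)`, stated for nonnegative measurable functions
(equivalent to boundedness on `L²(ν)` since the kernel is positive). -/
theorem stmt9 (μ : Measure ℂ) [IsFiniteMeasure μ] (hμ : μ ((Metric.sphere (0:ℂ) 1)ᶜ) = 0)
    (hμ0 : μ ≠ 0) (α ε : ℝ) (hε0 : 0 < ε) (hε1 : ε < 1) (hα : 1 - ε < α) :
    ∃ C : ℝ, 0 < C ∧ ∀ g : ℂ → ENNReal, Measurable g →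
      (∫⁻ z, (∫⁻ w, ENNReal.ofReal (kernL μ α z w) * g w ∂(nuMeas μ)) ^ 2 ∂(nuMeas μ))
        ≤ ENNReal.ofReal C * ∫⁻ w, (g w) ^ 2 ∂(nuMeas μ) := by
  have hα0 : 0 < α := by linarith
  obtain ⟨A, hA, hrow⟩ := exists_lintegral_kernL_mul_le μ hε0 hε1 hα0
  obtain ⟨B, hB, hcol⟩ := exists_lintegral_mul_kernL_le μ hμ hε1 hα0 hα
  refine ⟨A * B + 1, by positivity, fun g hg => ?_⟩
  have : SFinite (nuMeas μ) := by
    unfold nuMeas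
    infer_instance
  have hdisc := ae_nuMeas_norm_lt_one μ
  have h0 : ∀ᵐ z ∂(nuMeas μ), ENNReal.ofReal ((1 - ‖z‖ ^ 2) ^ (-ε)) ≠ 0 := by
    filter_upwards [hdisc] with z hz
    have hd : 0 < 1 - ‖z‖ ^ 2 := by nlinarith [norm_nonneg z]
    exact (ENNReal.ofReal_pos.2 (Real.rpow_pos_of_pos hd _)).ne'
  refine (lintegral_sq_le_of_schur (measurable_kernL μ α) (by fun_prop) h0
    (Filter.Eventually.of_forall fun _ => ENNReal.ofReal_ne_top) (hdisc.mono hrow)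
    (hdisc.mono hcol) hg).trans ?_
  rw [← ENNReal.ofReal_mul hA]
  gcongr
  linarith
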